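/- Fix 0<a<1/2 and u ∈ ℝ; for each positive integer n set q_n := exp(−2π n^{−a}) and M_n := exp(π n^a/12 − π n^{−a}/12) / (√(n^a)·(1 − exp(−2π n^{−a}))^{1/2 − n − n^a u}). Then there exist C>0 and N such that for all n ≥ N, |1/Γ_{q_n}(1/2 + n + n^a u) − M_n| ≤ C·exp(−2π n^a)·M_n. -/

import Mathlib

open Real

/-- The infinite q-shifted factorial `(a;q)_∞ = ∏_{k=0}^∞ (1 - a q^k)` (real version). -/
noncomputable def qPochInfR (a q : ℝ) : ℝ := ∏' k : ℕ, (1 - a * q ^ k)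

/-- The q-Gamma function `Γ_q(x) = (q;q)_∞ / (q^x;q)_∞ · (1-q)^{1-x}` for real `x`,
with real powers of the positive reals `q` and `1-q`. -/
noncomputable def qGamma (q x : ℝ) : ℝ :=
  qPochInfR q q / qPochInfR (q ^ x) q * (1 - q) ^ (1 - x)

/-- `M_n` from the statement. -/
noncomputable def stmt6M (a u : ℝ) (n : ℕ) : ℝ :=
  Real.exp (π * (n : ℝ) ^ a / 12 - π * (n : ℝ) ^ (-a) / 12) /
    (Real.sqrt ((n : ℝ) ^ a) *
      (1 - Real.exp (-2 * π * (n : ℝ) ^ (-a))) ^ (1 / 2 - (n : ℝ) - (n : ℝ) ^ a * u))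

lemma multipliable_qPochInfR (a : ℝ) {q : ℝ} (hq0 : 0 ≤ q) (hq1 : q < 1) :
    Multipliable fun k : ℕ ↦ 1 - a * q ^ k := by
  simp_rw [sub_eq_add_neg]
  exact Real.multipliable_one_add_of_summable
    ((summable_geometric_of_lt_one hq0 hq1).mul_left a).neg

lemma qPochInfR_le_one {a q : ℝ} (ha0 : 0 ≤ a) (ha1 : a ≤ 1) (hq0 : 0 ≤ q) (hq1 : q < 1) :
    qPochInfR a q ≤ 1 := by
  refine le_of_tendsto (multipliable_qPochInfR a hq0 hq1).hasProd (Filter.Eventually.of_forall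
    fun s ↦ Finset.prod_le_one (fun k _ ↦ ?_) fun k _ ↦ ?_)
  · have := mul_le_one₀ ha1 (pow_nonneg hq0 k) (pow_le_one₀ hq0 hq1.le)
    linarith
  · have := mul_nonneg ha0 (pow_nonneg hq0 k)
    linarith

lemma Finset.one_sub_sum_le_prod_one_sub {ι : Type*} (s : Finset ι) {f : ι → ℝ}
    (hf0 : ∀ i, 0 ≤ f i) (hf1 : ∀ i, f i ≤ 1) :
    1 - ∑ i ∈ s, f i ≤ ∏ i ∈ s, (1 - f i) := by
  classical
  induction s using Finset.induction_on with
  | empty => simp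
  | insert i s hi ih =>
    have hle : ∏ j ∈ s, (1 - f j) ≤ 1 :=
      Finset.prod_le_one (fun j _ ↦ sub_nonneg.mpr (hf1 j)) fun j _ ↦ by linarith [hf0 j]
    rw [Finset.sum_insert hi, Finset.prod_insert hi]
    nlinarith [mul_le_mul_of_nonneg_left hle (hf0 i)]

lemma one_sub_div_le_qPochInfR {a q : ℝ} (ha0 : 0 ≤ a) (ha1 : a ≤ 1) (hq0 : 0 ≤ q)
    (hq1 : q < 1) : 1 - a / (1 - q) ≤ qPochInfR a q := by
  have hsum : HasSum (fun k : ℕ ↦ a * q ^ k) (a / (1 - q)) :=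
    (hasSum_geometric_of_lt_one hq0 hq1).mul_left a
  refine ge_of_tendsto (multipliable_qPochInfR a hq0 hq1).hasProd (Filter.Eventually.of_forall
    fun s ↦ ?_)
  have hprod : 1 - ∑ k ∈ s, a * q ^ k ≤ ∏ k ∈ s, (1 - a * q ^ k) :=
    s.one_sub_sum_le_prod_one_sub (fun k ↦ mul_nonneg ha0 (pow_nonneg hq0 k))
      fun k ↦ mul_le_one₀ ha1 (pow_nonneg hq0 k) (pow_le_one₀ hq0 hq1.le)
  have := sum_le_hasSum s (fun k _ ↦ mul_nonneg ha0 (pow_nonneg hq0 k)) hsum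
  linarith

lemma eta_I_mul_ofReal {t : ℝ} (ht : 0 < t) :
    ModularForm.eta (Complex.I * t) =
      ((Real.exp (-π * t / 12) * qPochInfR (Real.exp (-2 * π * t)) (Real.exp (-2 * π * t)) : ℝ)
        : ℂ) := by
  have hq : Function.Periodic.qParam 1 (Complex.I * t) = ((Real.exp (-2 * π * t) : ℝ) : ℂ) := by
    rw [Function.Periodic.qParam]
    push_cast
    congr 1
    linear_combination (2 * π * t : ℂ) * Complex.I_sq
  have hq' : Function.Periodic.qParam 24 (Complex.I * t) = ((Real.exp (-π * t / 12) : ℝ) : ℂ) := by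
    rw [Function.Periodic.qParam]
    push_cast
    congr 1
    linear_combination (2 * π * t / 24 : ℂ) * Complex.I_sq
  have hlt : Real.exp (-2 * π * t) < 1 :=
    Real.exp_lt_one_iff.mpr (by nlinarith [mul_pos Real.pi_pos ht])
  have hprod := (multipliable_qPochInfR (Real.exp (-2 * π * t)) (Real.exp_pos _).le hlt).map_tprod
    Complex.ofRealHom Complex.continuous_ofReal
  simp only [Complex.ofRealHom_eq_coe] at hprod
  rw [ModularForm.eta, hq', qPochInfR, Complex.ofReal_mul, hprod]
  simp only [ModularForm.eta_q, hq]
  push_cast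
  simp only [pow_succ']

lemma qPochInfR_exp_inv {t : ℝ} (ht : 0 < t) :
    qPochInfR (Real.exp (-2 * π * t⁻¹)) (Real.exp (-2 * π * t⁻¹)) =
      √t * Real.exp (π * t⁻¹ / 12 - π * t / 12) *
        qPochInfR (Real.exp (-2 * π * t)) (Real.exp (-2 * π * t)) := by
  have h := ModularForm.eta_comp_eq_csqrt_I_inv (x := Complex.I * t) (by simpa using ht)
  have hinv : -1 / (Complex.I * t) = Complex.I * (t⁻¹ : ℝ) := by
    have : (t : ℂ) ≠ 0 := by exact_mod_cast ht.ne'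
    push_cast
    field_simp
    simp
  have hsqrt : Complex.sqrt (Complex.I * t) = Complex.sqrt Complex.I * (√t : ℝ) := by
    have ht' : (t : ℂ) ≠ 0 := by exact_mod_cast ht.ne'
    rw [sqrt_eq_exp (mul_ne_zero Complex.I_ne_zero ht'), mul_comm,
      Complex.log_ofReal_mul ht Complex.I_ne_zero, sqrt_eq_exp Complex.I_ne_zero,
      Real.sqrt_eq_rpow, Real.rpow_def_of_pos ht, Complex.ofReal_exp, ← Complex.exp_add]
    push_cast
    ring_nf
  have hI : Complex.sqrt Complex.I ≠ 0 := by simp [Complex.sqrt]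
  simp only [Function.comp_apply, Pi.smul_apply, Pi.mul_apply, smul_eq_mul, hinv, hsqrt,
    eta_I_mul_ofReal ht, eta_I_mul_ofReal (inv_pos.mpr ht)] at h
  rw [mul_assoc (Complex.sqrt Complex.I), inv_mul_cancel_left₀ hI] at h
  replace h := Complex.ofReal_injective (h.trans (Complex.ofReal_mul _ _).symm)
  have hexp : Real.exp (π * t⁻¹ / 12 - π * t / 12) =
      Real.exp (-π * t / 12) / Real.exp (-π * t⁻¹ / 12) := by
    rw [← Real.exp_sub]
    congr 1
    ring
  rw [hexp, ← mul_right_inj' (Real.exp_ne_zero (-π * t⁻¹ / 12)), h]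
  field_simp

lemma inv_one_sub_exp_neg_le {s : ℝ} (hs : 0 < s) : (1 - Real.exp (-s))⁻¹ ≤ 1 + s⁻¹ := by
  have h : Real.exp (-s) ≤ (s + 1)⁻¹ := by
    rw [Real.exp_neg]
    exact inv_anti₀ (by positivity) (Real.add_one_le_exp s)
  have h1 : s / (s + 1) ≤ 1 - Real.exp (-s) := by
    have : s / (s + 1) = 1 - (s + 1)⁻¹ := by field_simp; ring
    linarith
  calc (1 - Real.exp (-s))⁻¹ ≤ (s / (s + 1))⁻¹ := inv_anti₀ (by positivity) h1
    _ = 1 + s⁻¹ := by field_simp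

lemma exp_neg_two_pi_mul_le {t : ℝ} (ht : 1 ≤ t) : Real.exp (-2 * π * t) ≤ 1 / 4 := by
  have h : (2 * π * t + 1)⁻¹ ≤ 1 / 4 := by
    rw [one_div]
    exact inv_anti₀ (by norm_num) (by nlinarith [Real.pi_gt_three])
  refine le_trans ?_ h
  rw [show -2 * π * t = -(2 * π * t) by ring, Real.exp_neg]
  exact inv_anti₀ (by positivity) (Real.add_one_le_exp _)

lemma one_div_qGamma_exp {t x : ℝ} (ht : 0 < t) :
    1 / qGamma (Real.exp (-2 * π * t⁻¹)) x =
      Real.exp (π * t / 12 - π * t⁻¹ / 12) / (√t * (1 - Real.exp (-2 * π * t⁻¹)) ^ (1 - x)) *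
        (qPochInfR (Real.exp (-2 * π * t⁻¹) ^ x) (Real.exp (-2 * π * t⁻¹)) /
          qPochInfR (Real.exp (-2 * π * t)) (Real.exp (-2 * π * t))) := by
  rw [qGamma, qPochInfR_exp_inv ht,
    show π * t / 12 - π * t⁻¹ / 12 = -(π * t⁻¹ / 12 - π * t / 12) by ring, Real.exp_neg]
  simp only [div_eq_mul_inv, mul_inv, inv_inv, one_mul]
  ring

lemma abs_qPochInfR_div_sub_one_le {t x : ℝ} (ht : 1 ≤ t) (hx : 2 * t ^ 2 ≤ x) :
    |qPochInfR (Real.exp (-2 * π * t⁻¹) ^ x) (Real.exp (-2 * π * t⁻¹)) /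
        qPochInfR (Real.exp (-2 * π * t)) (Real.exp (-2 * π * t)) - 1| ≤
      4 * Real.exp (-2 * π * t) := by
  have ht0 : 0 < t := by linarith
  have hx0 : 0 ≤ x := le_trans (by positivity) hx
  have hs : 0 < 2 * π * t⁻¹ := by positivity
  set r := Real.exp (-2 * π * t) with hr
  set q := Real.exp (-2 * π * t⁻¹) with hq
  have hr0 : 0 < r := Real.exp_pos _
  have hr4 : r ≤ 1 / 4 := exp_neg_two_pi_mul_le ht
  have hq0 : 0 < q := Real.exp_pos _
  have hq1 : q < 1 := Real.exp_lt_one_iff.mpr (by linarith)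
  have hqx0 : 0 ≤ q ^ x := by positivity
  have hqx1 : q ^ x ≤ 1 := Real.rpow_le_one hq0.le hq1.le hx0
  have hε : q ^ x / (1 - q) ≤ r := by
    have h1 : (1 - q)⁻¹ ≤ Real.exp t := by
      refine le_trans (by simpa [hq] using inv_one_sub_exp_neg_le hs)
        (le_trans ?_ (Real.add_one_le_exp t))
      have : (2 * π * t⁻¹)⁻¹ = t / (2 * π) := by field_simp
      have : t / (2 * π) ≤ t := div_le_self ht0.le (by linarith [Real.pi_gt_three])
      simp only [mul_inv, inv_inv] at *
      linarith
    have h2 : q ^ x ≤ Real.exp (-2 * π * t - t) := by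
      rw [hq, ← Real.exp_mul]
      refine Real.exp_le_exp.mpr ?_
      have h3 : 2 * t ≤ t⁻¹ * x := by
        rw [inv_mul_eq_div, le_div_iff₀ ht0]
        linarith
      nlinarith [Real.pi_gt_three, mul_le_mul_of_nonneg_left h3 Real.pi_pos.le]
    calc q ^ x / (1 - q) ≤ Real.exp (-2 * π * t - t) * Real.exp t := by
          rw [div_eq_mul_inv]
          gcongr
      _ = r := by rw [← Real.exp_add]; congr 1; ring
  have hδ : r / (1 - r) ≤ 2 * r := by
    rw [div_le_iff₀ (by linarith)]
    nlinarith
  have hP := qPochInfR_le_one hqx0 hqx1 hq0.le hq1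
  have hP' := one_sub_div_le_qPochInfR hqx0 hqx1 hq0.le hq1
  have hQ := qPochInfR_le_one hr0.le (by linarith) hr0.le (by linarith : r < 1)
  have hQ' := one_sub_div_le_qPochInfR hr0.le (by linarith) hr0.le (by linarith : r < 1)
  have hQ0 : 1 / 2 ≤ qPochInfR r r := by linarith
  rw [div_sub_one (by linarith), abs_div, abs_of_pos (by linarith : 0 < qPochInfR r r),
    div_le_iff₀ (by linarith)]
  calc |qPochInfR (q ^ x) q - qPochInfR r r| ≤ 2 * r := by
        rw [abs_le]
        constructor <;> linarith
    _ ≤ 4 * r * qPochInfR r r := by nlinarith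

lemma eventually_two_mul_sq_rpow_le (u : ℝ) {a : ℝ} (ha0 : 0 < a) (ha1 : a < 1 / 2) :
    ∀ᶠ n : ℕ in Filter.atTop, 1 ≤ (n : ℝ) ^ a ∧
      2 * ((n : ℝ) ^ a) ^ 2 ≤ 1 / 2 + (n : ℝ) + (n : ℝ) ^ a * u := by
  have hlim : Filter.Tendsto (fun n : ℕ ↦ (n : ℝ) ^ (1 - 2 * a)) Filter.atTop Filter.atTop :=
    (tendsto_rpow_atTop (by linarith)).comp tendsto_natCast_atTop_atTop
  filter_upwards [hlim.eventually_ge_atTop (2 + |u|), Filter.eventually_ge_atTop 1] with n hn hn1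
  have hn1' : (1 : ℝ) ≤ n := by exact_mod_cast hn1
  have ht : 1 ≤ (n : ℝ) ^ a := Real.one_le_rpow hn1' ha0.le
  refine ⟨ht, ?_⟩
  have hsplit : (n : ℝ) = (n : ℝ) ^ (1 - 2 * a) * ((n : ℝ) ^ a) ^ 2 := by
    rw [← Real.rpow_mul_natCast (by positivity), ← Real.rpow_add (by positivity)]
    norm_num
    ring_nf
    simp
  have h1 : (2 + |u|) * ((n : ℝ) ^ a) ^ 2 ≤ n := by
    conv_rhs => rw [hsplit]
    gcongr
  have h2 : -((n : ℝ) ^ a * u) ≤ |u| * ((n : ℝ) ^ a) ^ 2 := by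
    calc -((n : ℝ) ^ a * u) = (n : ℝ) ^ a * -u := by ring
      _ ≤ (n : ℝ) ^ a * |u| := by gcongr; exact neg_le_abs u
      _ ≤ ((n : ℝ) ^ a) ^ 2 * |u| := by gcongr; exact le_self_pow₀ ht two_ne_zero
      _ = _ := mul_comm _ _
  linarith

theorem stmt6 (a u : ℝ) (ha0 : 0 < a) (ha1 : a < 1 / 2) :
    ∃ C > 0, ∃ N : ℕ, 0 < N ∧ ∀ n : ℕ, N ≤ n →
      |1 / qGamma (Real.exp (-2 * π * (n : ℝ) ^ (-a))) (1 / 2 + (n : ℝ) + (n : ℝ) ^ a * u) -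
          stmt6M a u n| ≤
        C * Real.exp (-2 * π * (n : ℝ) ^ a) * stmt6M a u n := by
  obtain ⟨N, hN⟩ := Filter.eventually_atTop.mp (eventually_two_mul_sq_rpow_le u ha0 ha1)
  refine ⟨4, by norm_num, N + 1, N.succ_pos, fun n hn ↦ ?_⟩
  obtain ⟨ht, hx⟩ := hN n (by lia)
  have hq1 : Real.exp (-2 * π * ((n : ℝ) ^ a)⁻¹) ≤ 1 :=
    Real.exp_le_one_iff.mpr (by
      have : 0 < π * ((n : ℝ) ^ a)⁻¹ := by positivity
      linarith)
  have hM : 0 ≤ stmt6M a u n := by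
    rw [stmt6M, Real.rpow_neg n.cast_nonneg]
    have := Real.rpow_nonneg (sub_nonneg.mpr hq1) (1 / 2 - (n : ℝ) - (n : ℝ) ^ a * u)
    positivity
  rw [stmt6M, Real.rpow_neg n.cast_nonneg] at hM ⊢
  rw [one_div_qGamma_exp (by linarith),
    show 1 - (1 / 2 + (n : ℝ) + (n : ℝ) ^ a * u) = 1 / 2 - (n : ℝ) - (n : ℝ) ^ a * u by ring,
    ← mul_sub_one, abs_mul, abs_of_nonneg hM, mul_comm]
  exact mul_le_mul_of_nonneg_right (abs_qPochInfR_div_sub_one_le ht hx) hM
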